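/- arXiv:1112.0670 — 2 statements merged into one kernel-verified Lean document; each statement's English description precedes it below -/
import Mathlib

section
/- With A = R⋆_αG and B = T⋆_βG as in the standing assumptions, if B is a unital ring, then A and B are Morita equivalent, i.e. the categories of left A-modules and of left B-modules are equivalent; explicitly, the six-tuple (A, B, 1_A·B, B·1_A, τ, τ') with τ(m⊗n) = mn and τ'(n⊗m) = nm is a strict Morita context. -/
universe u

/-- A groupoid in the algebraic sense of Lawson: a non-empty set `G` with a
partially defined binary operation (here modeled by a total operation `mul`
whose value is only constrained when it is defined, i.e. when `d g = r h`),
an inversion `inv`, and domain/range maps `d`, `r`. -/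
structure AlgGroupoid (G : Type u) where
  mul : G → G → G
  inv : G → G
  d : G → G
  r : G → G
  mul_assoc' : ∀ g h l, d g = r h → d h = r l → mul (mul g h) l = mul g (mul h l)
  mul_d : ∀ g, mul g (d g) = g
  r_mul : ∀ g, mul (r g) g = g
  inv_mul : ∀ g, mul (inv g) g = d g
  mul_inv : ∀ g, mul g (inv g) = r g
  d_mul : ∀ g h, d g = r h → d (mul g h) = d h
  r_mul' : ∀ g h, d g = r h → r (mul g h) = r g
  d_inv : ∀ g, d (inv g) = r g
  r_inv : ∀ g, r (inv g) = d g
  inv_inv : ∀ g, inv (inv g) = g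
  d_d : ∀ g, d (d g) = d g
  r_d : ∀ g, r (d g) = d g
  d_r : ∀ g, d (r g) = r g
  r_r : ∀ g, r (r g) = r g

/-- `e` is an identity element of the groupoid `𝔾`, i.e. an element of `G₀`. -/
def AlgGroupoid.isId {G : Type u} (𝔾 : AlgGroupoid G) (e : G) : Prop := 𝔾.d e = e

instance {G : Type u} [DecidableEq G] (𝔾 : AlgGroupoid G) (e : G) : Decidable (𝔾.isId e) :=
  inferInstanceAs (Decidable (𝔾.d e = e))

/-- `D` is a two-sided ideal of `E` (both being subsets of an ambient
non-unital ring `T`). -/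
structure IsIdealIn {T : Type u} [NonUnitalRing T] (D E : Set T) : Prop where
  subset : D ⊆ E
  zero_mem : (0 : T) ∈ D
  add_mem : ∀ ⦃x y : T⦄, x ∈ D → y ∈ D → x + y ∈ D
  neg_mem : ∀ ⦃x : T⦄, x ∈ D → -x ∈ D
  mul_mem_left : ∀ ⦃x y : T⦄, x ∈ E → y ∈ D → x * y ∈ D
  mul_mem_right : ∀ ⦃x y : T⦄, x ∈ D → y ∈ E → x * y ∈ D

/-- `u` is a (two-sided) multiplicative identity element of the subset `D`. -/
def IsIdentityElem {T : Type u} [NonUnitalRing T] (u : T) (D : Set T) : Prop :=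
  u ∈ D ∧ ∀ x ∈ D, u * x = x ∧ x * u = x

/-- A partial action `α = ({D_g}, {α_g})` of a groupoid `𝔾` on the ring whose
carrier is the subset `R` of the ambient non-unital ring `T` (take
`R = Set.univ` for a partial action on `T` itself).  For each `g`, `D (r g)`
is an ideal of `R`, `D g` is an ideal of `D (r g)` and `act g` restricts to a
ring isomorphism from `D (inv g)` onto `D g`; moreover `act e` is the identity
of `D e` for identities `e`, and for composable `g, h` the map `act (mul g h)`
extends `act g ∘ act h` (whose domain is `(act h)⁻¹ (D (inv g) ∩ D h)`). -/
structure PartialGroupoidAction {G : Type u} (𝔾 : AlgGroupoid G) (T : Type u)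
    [NonUnitalRing T] (R : Set T) where
  D : G → Set T
  act : G → T → T
  ideal_r : ∀ g, IsIdealIn (D (𝔾.r g)) R
  ideal : ∀ g, IsIdealIn (D g) (D (𝔾.r g))
  bijOn : ∀ g, Set.BijOn (act g) (D (𝔾.inv g)) (D g)
  map_add : ∀ g, ∀ x ∈ D (𝔾.inv g), ∀ y ∈ D (𝔾.inv g), act g (x + y) = act g x + act g y
  map_mul : ∀ g, ∀ x ∈ D (𝔾.inv g), ∀ y ∈ D (𝔾.inv g), act g (x * y) = act g x * act g y
  act_id : ∀ e, 𝔾.isId e → ∀ x ∈ D e, act e x = x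
  dom_cond : ∀ g h, 𝔾.d g = 𝔾.r h → ∀ x ∈ D (𝔾.inv h), act h x ∈ D (𝔾.inv g) →
    x ∈ D (𝔾.inv (𝔾.mul g h))
  comp_cond : ∀ g h, 𝔾.d g = 𝔾.r h → ∀ x ∈ D (𝔾.inv h), act h x ∈ D (𝔾.inv g) →
    act g (act h x) = act (𝔾.mul g h) x

/-- The partial action `α` is global if, for all composable `g, h`, the
composite `α_g ∘ α_h` (taken on its largest possible domain) coincides with
`α_{gh}`; since both maps always agree on the domain of the composite, this
amounts to the equality of the two domains. -/
def PartialGroupoidAction.IsGlobal {G : Type u} {𝔾 : AlgGroupoid G} {T : Type u}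
    [NonUnitalRing T] {R : Set T} (α : PartialGroupoidAction 𝔾 T R) : Prop :=
  ∀ g h, 𝔾.d g = 𝔾.r h →
    {x | x ∈ α.D (𝔾.inv h) ∧ α.act h x ∈ α.D (𝔾.inv g)} = α.D (𝔾.inv (𝔾.mul g h))

/-- A realization of the (partial) skew groupoid ring `R ⋆_α G` on the ring
`A`: the maps `δ g : D_g → A`, `x ↦ x·δ_g`, are additive, their images are
independent and span `A` (so `A = ⊕_{g ∈ G} D_g δ_g` as an additive group),
and multiplication is given by
`(x δ_g)(y δ_h) = α_g(α_{g⁻¹}(x) y) δ_{gh}` if `(g,h) ∈ G²` and `0` otherwise. -/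
structure SkewRingRep {G : Type u} (𝔾 : AlgGroupoid G) {T : Type u} [NonUnitalRing T]
    {R : Set T} (α : PartialGroupoidAction 𝔾 T R) (A : Type u) [NonUnitalRing A] where
  δ : G → T → A
  map_add : ∀ g, ∀ x ∈ α.D g, ∀ y ∈ α.D g, δ g (x + y) = δ g x + δ g y
  mul_of : ∀ g h, 𝔾.d g = 𝔾.r h → ∀ x ∈ α.D g, ∀ y ∈ α.D h,
    δ g x * δ h y = δ (𝔾.mul g h) (α.act g (α.act (𝔾.inv g) x * y))
  mul_of_ne : ∀ g h, 𝔾.d g ≠ 𝔾.r h → ∀ x ∈ α.D g, ∀ y ∈ α.D h, δ g x * δ h y = 0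
  indep : ∀ (s : Finset G) (c : G → T), (∀ g, c g ∈ α.D g) →
    (∑ g ∈ s, δ g (c g)) = 0 → ∀ g ∈ s, c g = 0
  spans : ∀ a : A, ∃ (s : Finset G) (c : G → T), (∀ g, c g ∈ α.D g) ∧ a = ∑ g ∈ s, δ g (c g)

section Corner

open CategoryTheory

variable {A B : Type u} [Ring A] [Ring B]

/-- The additive subgroup `e • M` of a `B`-module `M`, where `e = κ 1`. -/
def cornerModule (κ : A →ₙ+* B) (M : Type u) [AddCommGroup M] [Module B M] : AddSubgroup M where
  carrier := {m | κ 1 • m = m}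
  zero_mem' := smul_zero _
  add_mem' := fun {x y} hx hy => by
    rw [Set.mem_ofPred_eq] at hx hy ⊢
    rw [smul_add, hx, hy]
  neg_mem' := fun {x} hx => by
    rw [Set.mem_ofPred_eq] at hx ⊢
    rw [smul_neg, hx]

lemma mem_cornerModule {κ : A →ₙ+* B} {M : Type u} [AddCommGroup M] [Module B M] {m : M} :
    m ∈ cornerModule κ M ↔ κ 1 • m = m := Iff.rfl

lemma map_smul_mem_cornerModule (κ : A →ₙ+* B) {M : Type u} [AddCommGroup M] [Module B M]
    (a : A) (m : M) : κ a • m ∈ cornerModule κ M := by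
  rw [mem_cornerModule, smul_smul, ← map_mul, one_mul]

instance cornerModule.module (κ : A →ₙ+* B) (M : Type u) [AddCommGroup M] [Module B M] :
    Module A (cornerModule κ M) where
  smul a m := ⟨κ a • (m : M), map_smul_mem_cornerModule κ a (m : M)⟩
  one_smul m := Subtype.ext m.2
  mul_smul a b m := Subtype.ext <| by
    change κ (a * b) • (m : M) = κ a • κ b • (m : M)
    rw [map_mul, mul_smul]
  smul_zero a := Subtype.ext (smul_zero _)
  smul_add a m n := Subtype.ext (smul_add _ _ _)
  add_smul a b m := Subtype.ext <| by
    change κ (a + b) • (m : M) = κ a • (m : M) + κ b • (m : M)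
    rw [map_add, add_smul]
  zero_smul m := Subtype.ext <| by
    change κ 0 • (m : M) = 0
    rw [map_zero, zero_smul]

lemma cornerModule.coe_smul (κ : A →ₙ+* B) {M : Type u} [AddCommGroup M] [Module B M]
    (a : A) (m : cornerModule κ M) : ((a • m : cornerModule κ M) : M) = κ a • (m : M) := rfl

/-- The restriction of a `B`-linear map to the corners cut out by `κ 1`. -/
def cornerModule.map (κ : A →ₙ+* B) {M N : Type u} [AddCommGroup M] [Module B M]
    [AddCommGroup N] [Module B N] (f : M →ₗ[B] N) : cornerModule κ M →ₗ[A] cornerModule κ N where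
  toFun m := ⟨f m, by rw [mem_cornerModule, ← map_smul, mem_cornerModule.1 m.2]⟩
  map_add' m n := Subtype.ext (map_add f _ _)
  map_smul' a m := Subtype.ext (map_smul f (κ a) (m : M))

/-- The functor `M ↦ e • M` from `B`-modules to `A`-modules, where `e = κ 1`. -/
def cornerFunctor (κ : A →ₙ+* B) : ModuleCat.{u} B ⥤ ModuleCat.{u} A where
  obj M := ModuleCat.of A (cornerModule κ M)
  map f := ModuleCat.ofHom (cornerModule.map κ f.hom)

lemma exists_sum_mul_map_one_mul_eq_one {κ : A →ₙ+* B}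
    (hfull : ∀ b : B, ∃ (n : ℕ) (m k : Fin n → B), b = ∑ i, (m i * κ 1) * (κ 1 * k i)) :
    ∃ (n : ℕ) (m k : Fin n → B), ∑ i, m i * (κ 1 * k i) = 1 := by
  obtain ⟨n, m, k, h⟩ := hfull 1
  refine ⟨n, m, k, ?_⟩
  rw [h]
  refine Finset.sum_congr rfl fun i _ => ?_
  rw [mul_assoc (m i), ← mul_assoc (κ 1) (κ 1), ← map_mul, one_mul]

lemma map_one_mul_smul_mem_cornerModule (κ : A →ₙ+* B) {M : Type u} [AddCommGroup M] [Module B M]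
    (b : B) (x : M) : (κ 1 * b) • x ∈ cornerModule κ M := by
  rw [mul_smul]
  exact map_smul_mem_cornerModule κ 1 _

lemma cornerFunctor_faithful {κ : A →ₙ+* B} {n : ℕ} {m k : Fin n → B}
    (hmk : ∑ i, m i * (κ 1 * k i) = 1) : (cornerFunctor κ).Faithful where
  map_injective {M N f g} hfg := by
    ext x
    have key (b : B) : f.hom ((κ 1 * b) • x) = g.hom ((κ 1 * b) • x) :=
      congrArg Subtype.val (LinearMap.congr_fun (congrArg ModuleCat.Hom.hom hfg)
        (⟨(κ 1 * b) • x, map_one_mul_smul_mem_cornerModule κ b x⟩ : cornerModule κ M))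
    change f.hom x = g.hom x
    rw [← one_smul B x, ← hmk]
    simp only [Finset.sum_smul, map_sum, mul_smul (m _), map_smul f.hom (m _),
      map_smul g.hom (m _), key]

lemma cornerModule.exists_map_eq {κ : A →ₙ+* B}
    (hcorner : ∀ b : B, ∃ a, κ a = κ 1 * b * κ 1) {n : ℕ} {m k : Fin n → B}
    (hmk : ∑ i, m i * (κ 1 * k i) = 1) {M N : Type u} [AddCommGroup M] [Module B M]
    [AddCommGroup N] [Module B N] (φ : cornerModule κ M →ₗ[A] cornerModule κ N) :
    ∃ f : M →ₗ[B] N, cornerModule.map κ f = φ := by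
  let p (b : B) (x : M) : cornerModule κ M :=
    ⟨(κ 1 * b) • x, map_one_mul_smul_mem_cornerModule κ b x⟩
  have hp_add (b : B) (x y : M) : p b (x + y) = p b x + p b y := Subtype.ext (smul_add _ _ _)
  have hφ (c : B) (y : cornerModule κ M) :
      (φ (p c y) : N) = (κ 1 * c) • (φ y : N) := by
    obtain ⟨a, ha⟩ := hcorner c
    have h1 : p c y = a • y := Subtype.ext <| by
      rw [cornerModule.coe_smul, ha, mul_smul (κ 1 * c), mem_cornerModule.1 y.2]
    rw [h1, map_smul, cornerModule.coe_smul, ha, mul_smul (κ 1 * c),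
      mem_cornerModule.1 (φ y).2]
  have hone_smul {P : Type u} [AddCommGroup P] [Module B P] (x : P) :
      ∑ i, m i • (κ 1 * k i) • x = x := by
    simp only [← mul_smul, ← Finset.sum_smul, hmk, one_smul]
  have hexp (c : B) (x : M) : p c x = ∑ j, p (c * m j) (p (k j) x) := by
    refine Subtype.ext ?_
    rw [AddSubgroup.val_finsetSum]
    change (κ 1 * c) • x = ∑ j, (κ 1 * (c * m j)) • (κ 1 * k j) • x
    conv_lhs => rw [← hone_smul x, Finset.smul_sum]
    simp only [← mul_smul, mul_assoc]
  refine ⟨⟨⟨fun x => ∑ i, m i • (φ (p (k i) x) : N), fun x y => ?_⟩, fun b x => ?_⟩, ?_⟩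
  · simp only [hp_add, map_add, AddSubgroup.coe_add, smul_add, Finset.sum_add_distrib]
  · have hb (i : Fin n) : p (k i) (b • x) = p (k i * b) x := Subtype.ext <| by
      change (κ 1 * k i) • b • x = (κ 1 * (k i * b)) • x
      rw [← mul_smul, mul_assoc]
    have hb' (i : Fin n) : (φ (p (k i) (b • x)) : N)
        = (κ 1 * k i) • ∑ j, (b * m j) • (φ (p (k j) x) : N) := by
      rw [hb, hexp, map_sum, AddSubgroup.val_finsetSum, Finset.smul_sum]
      refine Finset.sum_congr rfl fun j _ => ?_
      rw [hφ, ← mul_smul]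
      simp only [mul_assoc]
    simp only [hb', hone_smul]
    simp only [mul_smul b, Finset.smul_sum, RingHom.id_apply]
  · refine LinearMap.ext fun y => Subtype.ext ?_
    change ∑ i, m i • (φ (p (k i) y) : N) = φ y
    simp only [hφ, hone_smul]

lemma cornerFunctor_full {κ : A →ₙ+* B} (hcorner : ∀ b : B, ∃ a, κ a = κ 1 * b * κ 1)
    {n : ℕ} {m k : Fin n → B} (hmk : ∑ i, m i * (κ 1 * k i) = 1) : (cornerFunctor κ).Full where
  map_surjective {M N} φ := by
    obtain ⟨f, hf⟩ := cornerModule.exists_map_eq hcorner hmk φ.hom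
    exact ⟨ModuleCat.ofHom f, ModuleCat.hom_ext hf⟩

/-- The group `Hom_A(eB, N)` coinduced from an `A`-module `N`, where `e = κ 1`, realized as the
group of additive maps `f : B →+ N` with `f (κ a * b) = a • f b`. -/
def cornerCoind (κ : A →ₙ+* B) (N : Type u) [AddCommGroup N] [Module A N] :
    AddSubgroup (B →+ N) where
  carrier := {f | ∀ a b, f (κ a * b) = a • f b}
  zero_mem' := fun a _ => (smul_zero a).symm
  add_mem' := fun {f g} hf hg a b => by
    rw [AddMonoidHom.add_apply, hf, hg, AddMonoidHom.add_apply, smul_add]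
  neg_mem' := fun {f} hf a b => by
    rw [AddMonoidHom.neg_apply, hf, AddMonoidHom.neg_apply, smul_neg]

instance cornerCoind.module (κ : A →ₙ+* B) (N : Type u) [AddCommGroup N] [Module A N] :
    Module B (cornerCoind κ N) where
  smul b f := ⟨(f : B →+ N).comp (AddMonoidHom.mulRight b), fun a x => by
    change (f : B →+ N) (κ a * x * b) = a • (f : B →+ N) (x * b)
    rw [mul_assoc, f.2]⟩
  one_smul f := Subtype.ext <| AddMonoidHom.ext fun x => congrArg (f : B →+ N) (mul_one x)
  mul_smul b c f := Subtype.ext <| AddMonoidHom.ext fun x =>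
    congrArg (f : B →+ N) (mul_assoc x b c).symm
  smul_zero b := rfl
  smul_add b f g := rfl
  add_smul b c f := Subtype.ext <| AddMonoidHom.ext fun x => by
    change (f : B →+ N) (x * (b + c)) = (f : B →+ N) (x * b) + (f : B →+ N) (x * c)
    rw [mul_add, map_add]
  zero_smul f := Subtype.ext <| AddMonoidHom.ext fun x => by
    change (f : B →+ N) (x * 0) = 0
    rw [mul_zero, map_zero]

lemma cornerCoind.smul_apply (κ : A →ₙ+* B) {N : Type u} [AddCommGroup N] [Module A N]
    (b : B) (f : cornerCoind κ N) (x : B) :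
    ((b • f : cornerCoind κ N) : B →+ N) x = (f : B →+ N) (x * b) := rfl

/-- Evaluation at `1` on the corner of the coinduced module. -/
def cornerCoind.eval (κ : A →ₙ+* B) (N : Type u) [AddCommGroup N] [Module A N] :
    cornerModule κ (cornerCoind κ N) →ₗ[A] N where
  toFun f := ((f : cornerCoind κ N) : B →+ N) 1
  map_add' f g := rfl
  map_smul' a f := by
    rw [cornerModule.coe_smul, cornerCoind.smul_apply, one_mul, ← mul_one (κ a),
      (f : cornerCoind κ N).2, RingHom.id_apply]

lemma cornerCoind.eval_bijective {κ : A →ₙ+* B} (hinj : Function.Injective κ)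
    (hcorner : ∀ b : B, ∃ a, κ a = κ 1 * b * κ 1) (N : Type u) [AddCommGroup N] [Module A N] :
    Function.Bijective (cornerCoind.eval κ N) := by
  choose q hq using hcorner
  have hq_add (x y : B) : q (x + y) = q x + q y := hinj <| by
    simp only [map_add, hq, mul_add, add_mul]
  have hq_mul (a : A) (x : B) : q (κ a * x) = a * q x := hinj <| by
    rw [map_mul, hq, hq, ← mul_assoc, ← mul_assoc, ← mul_assoc, ← map_mul, ← map_mul, one_mul,
      mul_one]
  have hq_map_one (x : B) : q (x * κ 1) = q x := hinj <| by
    rw [hq, hq, mul_assoc, mul_assoc x, ← map_mul, one_mul, mul_assoc]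
  have hq_one : q 1 = 1 := hinj <| by
    rw [hq, mul_one, ← map_mul, one_mul]
  constructor
  · rw [injective_iff_map_eq_zero]
    intro f hf
    change ((f : cornerCoind κ N) : B →+ N) 1 = 0 at hf
    refine Subtype.ext <| Subtype.ext <| AddMonoidHom.ext fun x => ?_
    have hfe (y : B) : ((f : cornerCoind κ N) : B →+ N) (y * κ 1)
        = ((f : cornerCoind κ N) : B →+ N) y :=
      DFunLike.congr_fun (congrArg Subtype.val (mem_cornerModule.1 f.2)) y
    calc ((f : cornerCoind κ N) : B →+ N) x
        = ((f : cornerCoind κ N) : B →+ N) (κ 1 * (x * κ 1)) := by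
          rw [(f : cornerCoind κ N).2, one_smul, hfe]
      _ = ((f : cornerCoind κ N) : B →+ N) (κ (q x) * 1) := by rw [hq, mul_one, mul_assoc]
      _ = 0 := by rw [(f : cornerCoind κ N).2, hf, smul_zero]
  · intro y
    let f : cornerCoind κ N := ⟨AddMonoidHom.mk' (fun x => q x • y) fun x x' => by
      rw [hq_add, add_smul], fun a x => by
        change q (κ a * x) • y = a • q x • y
        rw [hq_mul, mul_smul]⟩
    refine ⟨⟨f, ?_⟩, ?_⟩
    · refine mem_cornerModule.2 <| Subtype.ext <| AddMonoidHom.ext fun x => ?_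
      change q (x * κ 1) • y = q x • y
      rw [hq_map_one]
    · change q 1 • y = y
      rw [hq_one, one_smul]

lemma cornerFunctor_essSurj {κ : A →ₙ+* B} (hinj : Function.Injective κ)
    (hcorner : ∀ b : B, ∃ a, κ a = κ 1 * b * κ 1) : (cornerFunctor κ).EssSurj where
  mem_essImage N := ⟨ModuleCat.of B (cornerCoind κ N),
    ⟨(LinearEquiv.ofBijective _ (cornerCoind.eval_bijective hinj hcorner N)).toModuleIso⟩⟩

/-- If `κ` identifies `A` with the corner `eBe` of a full idempotent `e` of `B`, then the module
categories of `A` and `B` are equivalent. -/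
theorem nonempty_moduleCat_equivalence_of_full_corner {κ : A →ₙ+* B}
    (hinj : Function.Injective κ) (hcorner : ∀ b : B, ∃ a, κ a = κ 1 * b * κ 1)
    (hfull : ∀ b : B, ∃ (n : ℕ) (m k : Fin n → B), b = ∑ i, (m i * κ 1) * (κ 1 * k i)) :
    Nonempty (ModuleCat.{u} A ≌ ModuleCat.{u} B) := by
  obtain ⟨n, m, k, hmk⟩ := exists_sum_mul_map_one_mul_eq_one hfull
  have := cornerFunctor_faithful hmk
  have := cornerFunctor_full hcorner hmk
  have := cornerFunctor_essSurj hinj hcorner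
  have : (cornerFunctor κ).IsEquivalence := {}
  exact ⟨(cornerFunctor κ).asEquivalence.symm⟩

end Corner

section SkewRing

variable {G : Type u} {𝔾 : AlgGroupoid G} {T : Type u} [NonUnitalRing T] {R : Set T}

lemma AlgGroupoid.r_eq_of_isId {e : G} (he : 𝔾.isId e) : 𝔾.r e = e := by
  have h := 𝔾.r_d e
  rwa [show 𝔾.d e = e from he] at h

lemma AlgGroupoid.inv_eq_of_isId {e : G} (he : 𝔾.isId e) : 𝔾.inv e = e := by
  have h := 𝔾.mul_d (𝔾.inv e)
  rw [𝔾.d_inv, 𝔾.r_eq_of_isId he, 𝔾.inv_mul] at h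
  rw [← h]
  exact he

lemma AlgGroupoid.isId_d (g : G) : 𝔾.isId (𝔾.d g) := 𝔾.d_d g

lemma AlgGroupoid.isId_r (g : G) : 𝔾.isId (𝔾.r g) := 𝔾.d_r g

lemma AlgGroupoid.mul_inv_mul {g h : G} (hgh : 𝔾.r h = 𝔾.r g) :
    𝔾.mul h (𝔾.mul (𝔾.inv h) g) = g := by
  rw [← 𝔾.mul_assoc' h (𝔾.inv h) g (𝔾.r_inv h).symm ((𝔾.d_inv h).trans hgh), 𝔾.mul_inv, hgh,
    𝔾.r_mul]

lemma AlgGroupoid.r_inv_mul {g h : G} (hgh : 𝔾.r h = 𝔾.r g) :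
    𝔾.r (𝔾.mul (𝔾.inv h) g) = 𝔾.d h := by
  rw [𝔾.r_mul' _ _ ((𝔾.d_inv h).trans hgh), 𝔾.r_inv]

lemma IsIdealIn.mul_mem_self {D E : Set T} (h : IsIdealIn D E) {x y : T} (hx : x ∈ D)
    (hy : y ∈ D) : x * y ∈ D := h.mul_mem_left (h.subset hx) hy

namespace PartialGroupoidAction

variable {β : PartialGroupoidAction 𝔾 T R}

lemma act_mem (β : PartialGroupoidAction 𝔾 T R) {g : G} {x : T} (hx : x ∈ β.D (𝔾.inv g)) :
    β.act g x ∈ β.D g := (β.bijOn g).mapsTo hx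

lemma act_inv_mem (β : PartialGroupoidAction 𝔾 T R) {g : G} {x : T} (hx : x ∈ β.D g) :
    β.act (𝔾.inv g) x ∈ β.D (𝔾.inv g) :=
  β.act_mem (by rwa [𝔾.inv_inv])

lemma act_act_inv (β : PartialGroupoidAction 𝔾 T R) {g : G} {x : T} (hx : x ∈ β.D g) :
    β.act g (β.act (𝔾.inv g) x) = x := by
  rw [β.comp_cond g (𝔾.inv g) (𝔾.r_inv g).symm x (by rwa [𝔾.inv_inv]) (β.act_inv_mem hx),
    𝔾.mul_inv]
  exact β.act_id _ (𝔾.isId_r g) x ((β.ideal g).subset hx)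

lemma act_inv_act (β : PartialGroupoidAction 𝔾 T R) {g : G} {x : T} (hx : x ∈ β.D (𝔾.inv g)) :
    β.act (𝔾.inv g) (β.act g x) = x := by
  have h := β.act_act_inv hx
  rwa [𝔾.inv_inv] at h

lemma IsGlobal.D_r (hβ : β.IsGlobal) (g : G) : β.D (𝔾.r g) = β.D g := by
  refine Set.Subset.antisymm (fun x hx => ?_) (β.ideal g).subset
  have h := hβ g (𝔾.inv g) (𝔾.r_inv g).symm
  rw [𝔾.mul_inv, 𝔾.inv_eq_of_isId (𝔾.isId_r g), 𝔾.inv_inv] at h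
  rw [← h] at hx
  exact hx.1

lemma IsGlobal.D_inv (hβ : β.IsGlobal) (g : G) : β.D (𝔾.inv g) = β.D (𝔾.d g) := by
  rw [← hβ.D_r, 𝔾.r_inv]

lemma mul_mem (β : PartialGroupoidAction 𝔾 T R) {g : G} {x y : T} (hx : x ∈ β.D g)
    (hy : y ∈ β.D g) : x * y ∈ β.D g := (β.ideal g).mul_mem_self hx hy

end PartialGroupoidAction

namespace SkewRingRep

variable {β : PartialGroupoidAction 𝔾 T R} {B : Type u}

lemma δ_zero [NonUnitalRing B] (ρ : SkewRingRep 𝔾 β B) (g : G) : ρ.δ g 0 = 0 := by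
  have h := ρ.map_add g 0 (β.ideal g).zero_mem 0 (β.ideal g).zero_mem
  rwa [add_zero, left_eq_add] at h

lemma δ_neg [NonUnitalRing B] (ρ : SkewRingRep 𝔾 β B) {g : G} {x : T} (hx : x ∈ β.D g) :
    ρ.δ g (-x) = -ρ.δ g x := by
  have h := ρ.map_add g x hx (-x) ((β.ideal g).neg_mem hx)
  rw [add_neg_cancel, ρ.δ_zero] at h
  exact (neg_eq_of_add_eq_zero_right h.symm).symm

/-- A sum of elements `u_e δ_e` over the identities `e` acts on the right of `x δ_g` through its
component at `d g`. -/
lemma δ_mul_sum [NonUnitalRing B] (ρ : SkewRingRep 𝔾 β B) {G₀ : Finset G}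
    (hG₀ : ∀ e, e ∈ G₀ ↔ 𝔾.isId e) {u : G → T} (hu : ∀ e, 𝔾.isId e → u e ∈ β.D e)
    {g : G} {x : T} (hx : x ∈ β.D g) :
    ρ.δ g x * ∑ e ∈ G₀, ρ.δ e (u e) = ρ.δ g (β.act g (β.act (𝔾.inv g) x * u (𝔾.d g))) := by
  rw [Finset.mul_sum, Finset.sum_eq_single_of_mem (𝔾.d g) ((hG₀ _).2 (𝔾.isId_d g)),
    ρ.mul_of g (𝔾.d g) (𝔾.r_d g).symm x hx _ (hu _ (𝔾.isId_d g)), 𝔾.mul_d]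
  intro e he hne
  have he' := (hG₀ e).1 he
  refine ρ.mul_of_ne g e (fun h => hne ?_) x hx _ (hu e he')
  rw [h, 𝔾.r_eq_of_isId he']

/-- A sum of elements `u_e δ_e` over the identities `e` acts on the left of `x δ_g` through its
component at `r g`. -/
lemma sum_mul_δ [NonUnitalRing B] (ρ : SkewRingRep 𝔾 β B) (hβ : β.IsGlobal) {G₀ : Finset G}
    (hG₀ : ∀ e, e ∈ G₀ ↔ 𝔾.isId e) {u : G → T} (hu : ∀ e, 𝔾.isId e → u e ∈ β.D e)
    {g : G} {x : T} (hx : x ∈ β.D g) :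
    (∑ e ∈ G₀, ρ.δ e (u e)) * ρ.δ g x = ρ.δ g (u (𝔾.r g) * x) := by
  have hr := 𝔾.isId_r g
  have hxr : x ∈ β.D (𝔾.r g) := by rwa [hβ.D_r]
  rw [Finset.sum_mul, Finset.sum_eq_single_of_mem (𝔾.r g) ((hG₀ _).2 hr),
    ρ.mul_of (𝔾.r g) g (𝔾.d_r g) _ (hu _ hr) x hx, 𝔾.r_mul, 𝔾.inv_eq_of_isId hr,
    β.act_id _ hr _ (hu _ hr), β.act_id _ hr _ (β.mul_mem (hu _ hr) hxr)]
  intro e he hne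
  have he' := (hG₀ e).1 he
  exact ρ.mul_of_ne e g (fun h => hne (by rw [← h, show 𝔾.d e = e from he'])) _ (hu e he') x hx

end SkewRingRep

/-- If two skew rings are related by a map compatible with the `δ` maps, and the domains of the
first are contained in those of the second, then this map is injective. -/
lemma SkewRingRep.injective_of_map_δ {R' : Set T} {α : PartialGroupoidAction 𝔾 T R'}
    {β : PartialGroupoidAction 𝔾 T R} (hαβ : ∀ g, α.D g ⊆ β.D g) {A B : Type u} [Ring A] [Ring B]
    (σ : SkewRingRep 𝔾 α A) (ρ : SkewRingRep 𝔾 β B) (κ : A →ₙ+* B)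
    (hκ : ∀ g, ∀ x ∈ α.D g, κ (σ.δ g x) = ρ.δ g x) : Function.Injective κ := by
  rw [injective_iff_map_eq_zero]
  intro a ha
  obtain ⟨s, c, hc, rfl⟩ := σ.spans a
  rw [map_sum, Finset.sum_congr rfl fun g _ => hκ g (c g) (hc g)] at ha
  have h0 := ρ.indep s c (fun g => hαβ g (hc g)) ha
  exact Finset.sum_eq_zero fun g hg => by rw [h0 g hg, σ.δ_zero]

variable {α : PartialGroupoidAction 𝔾 T R} {β : PartialGroupoidAction 𝔾 T (Set.univ : Set T)}

lemma PartialGroupoidAction.D_subset_of_ideal (hβ : β.IsGlobal)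
    (hDE : ∀ e, 𝔾.isId e → IsIdealIn (α.D e) (β.D e)) (g : G) : α.D g ⊆ β.D g := fun x hx => by
  rw [← hβ.D_r]
  exact (hDE _ (𝔾.isId_r g)).subset ((α.ideal g).subset hx)

lemma PartialGroupoidAction.act_act_inv_mul_mem (hβ : β.IsGlobal)
    (hDE : ∀ e, 𝔾.isId e → IsIdealIn (α.D e) (β.D e))
    (hcompatD : ∀ g, α.D g = α.D (𝔾.r g) ∩ (β.act g '' α.D (𝔾.d g)))
    {g : G} {u v b : T} (hu : u ∈ α.D (𝔾.r g)) (hv : v ∈ α.D (𝔾.d g)) (hb : b ∈ β.D g) :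
    β.act g (β.act (𝔾.inv g) (u * b) * v) ∈ α.D g := by
  have hr := hDE _ (𝔾.isId_r g)
  have hd := hDE _ (𝔾.isId_d g)
  have hvd : v ∈ β.D (𝔾.inv g) := hβ.D_inv g ▸ hd.subset hv
  have hub : u * b ∈ α.D (𝔾.r g) := hr.mul_mem_right hu (by rwa [hβ.D_r])
  have hub' : u * b ∈ β.D g := hβ.D_r g ▸ hr.subset hub
  have hinv := β.act_inv_mem hub'
  rw [hcompatD]
  refine ⟨?_, ⟨_, hd.mul_mem_left (hβ.D_inv g ▸ hinv) hv, rfl⟩⟩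
  rw [β.map_mul g _ hinv _ hvd, β.act_act_inv hub']
  exact hr.mul_mem_right hub (by rw [hβ.D_r]; exact β.act_mem hvd)

lemma SkewRingRep.exists_map_eq_corner (hβ : β.IsGlobal)
    (hDE : ∀ e, 𝔾.isId e → IsIdealIn (α.D e) (β.D e))
    (hcompatD : ∀ g, α.D g = α.D (𝔾.r g) ∩ (β.act g '' α.D (𝔾.d g)))
    {G₀ : Finset G} (hG₀ : ∀ e, e ∈ G₀ ↔ 𝔾.isId e) {u : G → T} (hu : ∀ e, u e ∈ α.D e)
    {A B : Type u} [Ring A] [Ring B] (σ : SkewRingRep 𝔾 α A) (ρ : SkewRingRep 𝔾 β B)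
    (κ : A →ₙ+* B) (hκ : ∀ g, ∀ x ∈ α.D g, κ (σ.δ g x) = ρ.δ g x) (b : B) :
    ∃ a, κ a = (∑ e ∈ G₀, ρ.δ e (u e)) * b * ∑ e ∈ G₀, ρ.δ e (u e) := by
  have hsub := PartialGroupoidAction.D_subset_of_ideal hβ hDE
  have hu' (e : G) (_ : 𝔾.isId e) : u e ∈ β.D e := hsub e (hu e)
  obtain ⟨s, c, hc, rfl⟩ := ρ.spans b
  refine ⟨∑ g ∈ s, σ.δ g (β.act g (β.act (𝔾.inv g) (u (𝔾.r g) * c g) * u (𝔾.d g))), ?_⟩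
  rw [map_sum, Finset.mul_sum s, Finset.sum_mul s]
  refine Finset.sum_congr rfl fun g _ => ?_
  have hug : u (𝔾.r g) ∈ β.D g := hβ.D_r g ▸ hu' _ (𝔾.isId_r g)
  rw [ρ.sum_mul_δ hβ hG₀ hu' (hc g), ρ.δ_mul_sum hG₀ hu' (β.mul_mem hug (hc g)),
    hκ g _ (PartialGroupoidAction.act_act_inv_mul_mem hβ hDE hcompatD (hu _) (hu _) (hc g))]

lemma exists_fin_sum_of_mem_closure {B : Type u} [Ring B] {e b : B}
    (hb : b ∈ AddSubgroup.closure {y | ∃ m k, y = (m * e) * (e * k)}) :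
    ∃ (n : ℕ) (m k : Fin n → B), b = ∑ i, (m i * e) * (e * k i) := by
  induction hb using AddSubgroup.closure_induction with
  | mem y hy =>
    obtain ⟨m, k, rfl⟩ := hy
    exact ⟨1, fun _ => m, fun _ => k, by simp⟩
  | zero => exact ⟨0, fun _ => 0, fun _ => 0, by simp⟩
  | add y z _ _ hy hz =>
    obtain ⟨n, m, k, rfl⟩ := hy
    obtain ⟨n', m', k', rfl⟩ := hz
    exact ⟨n + n', Fin.append m m', Fin.append k k', by simp [Fin.sum_univ_add]⟩
  | neg y _ hy =>
    obtain ⟨n, m, k, rfl⟩ := hy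
    exact ⟨n, fun i => -m i, k, by simp⟩

lemma SkewRingRep.exists_eq_sum_mul_idempotent_mul (hβ : β.IsGlobal)
    (hDE : ∀ e, 𝔾.isId e → IsIdealIn (α.D e) (β.D e))
    (hspans : ∀ g, β.D g
      = ↑(AddSubgroup.closure (⋃ h ∈ {h : G | 𝔾.r h = 𝔾.r g}, β.act h '' α.D (𝔾.d h))))
    {G₀ : Finset G} (hG₀ : ∀ e, e ∈ G₀ ↔ 𝔾.isId e)
    {one : G → T} (hone : ∀ g, IsIdentityElem (one g) (α.D g))
    {B : Type u} [Ring B] (ρ : SkewRingRep 𝔾 β B) (b : B) :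
    ∃ (n : ℕ) (m k : Fin n → B),
      b = ∑ i, (m i * ∑ e ∈ G₀, ρ.δ e (one e)) * ((∑ e ∈ G₀, ρ.δ e (one e)) * k i) := by
  have hone' (e : G) (he : 𝔾.isId e) : one e ∈ β.D e := (hDE e he).subset (hone e).1
  apply exists_fin_sum_of_mem_closure
  obtain ⟨s, c, hc, rfl⟩ := ρ.spans b
  refine sum_mem fun g _ => ?_
  have hcg : c g ∈ AddSubgroup.closure
      (⋃ h ∈ {h : G | 𝔾.r h = 𝔾.r g}, β.act h '' α.D (𝔾.d h)) := by
    rw [← SetLike.mem_coe, ← hspans]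
    exact hc g
  generalize c g = x at hcg
  induction hcg using AddSubgroup.closure_induction with
  | mem x hx =>
    simp only [Set.mem_iUnion, exists_prop] at hx
    obtain ⟨h, hgh, a, ha, rfl⟩ := hx
    replace hgh : 𝔾.r h = 𝔾.r g := hgh
    have haβ : a ∈ β.D (𝔾.inv h) := hβ.D_inv h ▸ (hDE _ (𝔾.isId_d h)).subset ha
    have hx := β.act_mem haβ
    have hk : one (𝔾.d h) ∈ β.D (𝔾.mul (𝔾.inv h) g) := by
      rw [← hβ.D_r, 𝔾.r_inv_mul hgh]
      exact hone' _ (𝔾.isId_d h)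
    refine AddSubgroup.subset_closure
      ⟨ρ.δ h (β.act h a), ρ.δ (𝔾.mul (𝔾.inv h) g) (one (𝔾.d h)), ?_⟩
    have he : ρ.δ h (β.act h a) * ∑ e ∈ G₀, ρ.δ e (one e) = ρ.δ h (β.act h a) := by
      rw [ρ.δ_mul_sum hG₀ hone' hx, β.act_inv_act haβ, ((hone _).2 a ha).2]
    rw [← mul_assoc, he, he, ρ.mul_of _ _ (𝔾.r_inv_mul hgh).symm _ hx _ hk, β.act_inv_act haβ,
      ((hone _).2 a ha).2, 𝔾.mul_inv_mul hgh]
  | zero =>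
    rw [ρ.δ_zero]
    exact zero_mem _
  | add x y hx hy ihx ihy =>
    rw [← SetLike.mem_coe, ← hspans] at hx hy
    rw [ρ.map_add g x hx y hy]
    exact add_mem ihx ihy
  | neg x hx ihx =>
    rw [← SetLike.mem_coe, ← hspans] at hx
    rw [ρ.δ_neg hx]
    exact neg_mem ihx

end SkewRing

open CategoryTheory in
/-- **Theorem 3.2**: with `A = R ⋆_α G` and `B = T ⋆_β G` as in the standing
assumptions, if `B` is unital then `A` and `B` are Morita equivalent: the
categories of left `A`-modules and left `B`-modules are equivalent, and the
Morita context `(A, B, 1_A·B, B·1_A, τ, τ')` with `τ(m ⊗ n) = mn`,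
`τ'(n ⊗ m) = nm` is strict (i.e. `τ` and `τ'` are surjective, which amounts to
`1_A·B·1_A = A` and `B·1_A·B = B`). -/
theorem skew_rings_morita_equivalent {G : Type u} [Nonempty G] (𝔾 : AlgGroupoid G)
    {T : Type u} [NonUnitalRing T] {Rset : Set T}
    (α : PartialGroupoidAction 𝔾 T Rset)
    (β : PartialGroupoidAction 𝔾 T (Set.univ : Set T)) (hglobal : β.IsGlobal)
    (hDE : ∀ e, 𝔾.isId e → IsIdealIn (α.D e) (β.D e))
    (hcompatD : ∀ g, α.D g = α.D (𝔾.r g) ∩ (β.act g '' α.D (𝔾.d g)))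
    (hcompatAct : ∀ g, ∀ a ∈ α.D (𝔾.inv g), β.act g a = α.act g a)
    (hspans : ∀ g, β.D g
      = ↑(AddSubgroup.closure (⋃ h ∈ {h : G | 𝔾.r h = 𝔾.r g}, β.act h '' α.D (𝔾.d h))))
    (one : G → T) (hone : ∀ g, IsIdentityElem (one g) (α.D g))
    (hcentral : ∀ g (t : T), one g * t = t * one g)
    (G₀ : Finset G) (hG₀ : ∀ e, e ∈ G₀ ↔ 𝔾.isId e)
    {A : Type u} [Ring A] (σ : SkewRingRep 𝔾 α A)
    (h1A : (1 : A) = ∑ e ∈ G₀, σ.δ e (one e))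
    {B : Type u} [Ring B] (ρ : SkewRingRep 𝔾 β B)
    (κ : A →ₙ+* B) (hκ : ∀ g, ∀ x ∈ α.D g, κ (σ.δ g x) = ρ.δ g x) :
    Nonempty (ModuleCat.{u} A ≌ ModuleCat.{u} B) ∧
    (let oneA : B := ∑ e ∈ G₀, ρ.δ e (one e)
     (∀ a : A, ∃ (n : ℕ) (m k : Fin n → B),
        κ a = ∑ i, (oneA * m i) * (k i * oneA)) ∧
     (∀ b : B, ∃ (n : ℕ) (m k : Fin n → B),
        b = ∑ i, (m i * oneA) * (oneA * k i))) := by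
  have hone₁ : κ 1 = ∑ e ∈ G₀, ρ.δ e (one e) := by
    rw [h1A, map_sum]
    exact Finset.sum_congr rfl fun e _ => hκ e _ (hone e).1
  have hfull := ρ.exists_eq_sum_mul_idempotent_mul hglobal hDE hspans hG₀ hone
  have hcorner := SkewRingRep.exists_map_eq_corner hglobal hDE hcompatD hG₀
    (fun e => (hone e).1) σ ρ κ hκ
  have hinj := SkewRingRep.injective_of_map_δ
    (PartialGroupoidAction.D_subset_of_ideal hglobal hDE) σ ρ κ hκ
  rw [← hone₁] at hfull hcorner ⊢
  refine ⟨nonempty_moduleCat_equivalence_of_full_corner hinj hcorner hfull, fun a => ?_, hfull⟩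
  refine ⟨1, fun _ => κ a, fun _ => 1, ?_⟩
  rw [Fin.sum_univ_one, one_mul, ← map_mul, ← map_mul, one_mul, mul_one]
end

section
/- Under the standing hypotheses, suppose at least one of the following holds: (a) R is a commutative ring; (b) t_α(1_R) is invertible in R; (c) for every e ∈ G₀, |G_e|·1_e is invertible in D_e and t_α restricted to D_e equals the trace map t_{α_{(e)}} of the partial action α_{(e)} of the isotropy group G_e on D_e. Then R is an α-partial Galois extension of R^α if and only if the Morita context (R⋆_αG, R^α, R, R, τ, τ') is strict. -/
universe u

/-- The subring `R^α` of invariants of `R` under the partial action `α`,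
where `one g` denotes the identity element `1_g` of the ideal `D_g`. -/
def invariants {G : Type u} (𝔾 : AlgGroupoid G) {R : Type u} [Ring R]
    (α : PartialGroupoidAction 𝔾 R (Set.univ : Set R)) (one : G → R) : Set R :=
  {x : R | ∀ g : G, α.act g (x * one (𝔾.inv g)) = x * one g}

/-- The trace map `t_α : R → R`, `t_α(x) = ∑_{g ∈ G} α_g(x 1_{g⁻¹})`. -/
def traceMap {G : Type u} [Fintype G] (𝔾 : AlgGroupoid G) {R : Type u} [Ring R]
    (α : PartialGroupoidAction 𝔾 R (Set.univ : Set R)) (one : G → R) (x : R) : R :=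
  ∑ g : G, α.act g (x * one (𝔾.inv g))

/-- `R` is an `α`-partial Galois extension of `R^α`: there is a partial Galois
coordinate system `x_i, y_i ∈ R` with
`∑_i x_i α_g(y_i 1_{g⁻¹}) = δ_{e,g} 1_e` for all `e ∈ G₀`, `g ∈ G`. -/
def IsPartialGalois {G : Type u} [Fintype G] [DecidableEq G] (𝔾 : AlgGroupoid G)
    {R : Type u} [Ring R] (α : PartialGroupoidAction 𝔾 R (Set.univ : Set R))
    (one : G → R) : Prop :=
  ∃ (n : ℕ) (xs ys : Fin n → R), ∀ g : G,
    ∑ i, xs i * α.act g (ys i * one (𝔾.inv g)) = if 𝔾.isId g then one g else 0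

namespace AlgGroupoid

variable {G : Type u} (𝔾 : AlgGroupoid G)

theorem isId_d_s19 (g : G) : 𝔾.isId (𝔾.d g) := 𝔾.d_d g

theorem isId_r_s19 (g : G) : 𝔾.isId (𝔾.r g) := 𝔾.d_r g

variable {𝔾}

theorem isId.r_eq {e : G} (he : 𝔾.isId e) : 𝔾.r e = e := by
  have h := 𝔾.r_d e
  rwa [show 𝔾.d e = e from he] at h

theorem isId.inv_eq {e : G} (he : 𝔾.isId e) : 𝔾.inv e = e := by
  have h₁ := 𝔾.mul_d (𝔾.inv e)
  rw [𝔾.d_inv, he.r_eq, 𝔾.inv_mul] at h₁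
  exact h₁.symm.trans he

variable (𝔾)

theorem inv_mul_cancel_left {g h : G} (hgh : 𝔾.r g = 𝔾.r h) :
    𝔾.mul g (𝔾.mul (𝔾.inv g) h) = h := by
  rw [← 𝔾.mul_assoc' _ _ _ (𝔾.r_inv g).symm ((𝔾.d_inv g).trans hgh), 𝔾.mul_inv, hgh, 𝔾.r_mul]

theorem mul_inv_cancel_left {g h : G} (hgh : 𝔾.d g = 𝔾.r h) :
    𝔾.mul (𝔾.inv g) (𝔾.mul g h) = h := by
  rw [← 𝔾.mul_assoc' _ _ _ (𝔾.d_inv g) hgh, 𝔾.inv_mul, hgh, 𝔾.r_mul]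

theorem mul_inv_cancel_right {g h : G} (hgh : 𝔾.d g = 𝔾.r h) :
    𝔾.mul (𝔾.mul g h) (𝔾.inv h) = g := by
  rw [𝔾.mul_assoc' _ _ _ hgh (𝔾.r_inv h).symm, 𝔾.mul_inv, ← hgh, 𝔾.mul_d]

theorem inv_mul_cancel_right {g h : G} (hgh : 𝔾.d g = 𝔾.d h) :
    𝔾.mul (𝔾.mul g (𝔾.inv h)) h = g := by
  rw [𝔾.mul_assoc' _ _ _ (hgh.trans (𝔾.r_inv h).symm) (𝔾.d_inv h), 𝔾.inv_mul, ← hgh, 𝔾.mul_d]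

theorem mul_inv_mul_self {h g : G} (hhg : 𝔾.d h = 𝔾.r g) :
    𝔾.mul g (𝔾.inv (𝔾.mul h g)) = 𝔾.inv h := by
  have hr : 𝔾.r (𝔾.inv (𝔾.mul h g)) = 𝔾.d g := (𝔾.r_inv _).trans (𝔾.d_mul _ _ hhg)
  have hk : 𝔾.d h = 𝔾.r (𝔾.mul g (𝔾.inv (𝔾.mul h g))) := by
    rw [𝔾.r_mul' _ _ hr.symm, hhg]
  rw [← 𝔾.mul_inv_cancel_left hk, ← 𝔾.mul_assoc' _ _ _ hhg hr.symm, 𝔾.mul_inv,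
    𝔾.r_mul' _ _ hhg, ← 𝔾.d_inv, 𝔾.mul_d]

theorem eq_of_isId_inv_mul {g h : G} (hgh : 𝔾.r g = 𝔾.r h)
    (hid : 𝔾.isId (𝔾.mul (𝔾.inv g) h)) : h = g := by
  have hr : 𝔾.mul (𝔾.inv g) h = 𝔾.d g := by
    rw [← hid.r_eq, 𝔾.r_mul' _ _ ((𝔾.d_inv g).trans hgh), 𝔾.r_inv]
  rw [← 𝔾.inv_mul_cancel_left hgh, hr, 𝔾.mul_d]

end AlgGroupoid

/-- The elements `one g` are central identities of the ideals `D g`, and the ideals attached to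
distinct identities of the groupoid are orthogonal. -/
structure HasCentralUnits {G : Type u} {𝔾 : AlgGroupoid G} {R : Type u} [Ring R]
    (α : PartialGroupoidAction 𝔾 R (Set.univ : Set R)) (one : G → R) : Prop where
  isIdentity : ∀ g, IsIdentityElem (one g) (α.D g)
  central : ∀ g (x : R), one g * x = x * one g
  orth : ∀ e f, 𝔾.isId e → 𝔾.isId f → e ≠ f → ∀ x ∈ α.D e, ∀ y ∈ α.D f, x * y = 0

namespace HasCentralUnits

variable {G : Type u} {𝔾 : AlgGroupoid G} {R : Type u} [Ring R]
  {α : PartialGroupoidAction 𝔾 R (Set.univ : Set R)} {one : G → R}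

theorem one_mem (H : HasCentralUnits α one) (g : G) : one g ∈ α.D g := (H.isIdentity g).1

theorem mul_one_of_mem (H : HasCentralUnits α one)
    {g : G} {x : R} (hx : x ∈ α.D g) : x * one g = x :=
  ((H.isIdentity g).2 x hx).2

theorem mul_mem (H : HasCentralUnits α one)
    {g : G} {x : R} (hx : x ∈ α.D g) (y : R) : y * x ∈ α.D g := by
  have hr := H.mul_one_of_mem ((α.ideal g).subset hx)
  rw [← H.central] at hr
  rw [← hr, ← mul_assoc]
  exact (α.ideal g).mul_mem_left
    ((α.ideal_r g).mul_mem_left (Set.mem_univ y) (H.one_mem _)) hx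

theorem mul_one_mem (H : HasCentralUnits α one)
    (g : G) (x : R) : x * one g ∈ α.D g := H.mul_mem (H.one_mem g) x

theorem mul_mem_right (H : HasCentralUnits α one)
    {g : G} {x : R} (hx : x ∈ α.D g) (y : R) : x * y ∈ α.D g := by
  rw [← H.mul_one_of_mem hx, mul_assoc, H.central, ← mul_assoc]
  exact H.mul_one_mem g _

theorem act_act_inv {g : G} {x : R} (hx : x ∈ α.D g) : α.act g (α.act (𝔾.inv g) x) = x := by
  have hx' : x ∈ α.D (𝔾.inv (𝔾.inv g)) := by rwa [𝔾.inv_inv]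
  rw [α.comp_cond g (𝔾.inv g) (𝔾.r_inv g).symm x hx' ((α.bijOn _).mapsTo hx'), 𝔾.mul_inv,
    α.act_id _ (𝔾.isId_r_s19 g) _ ((α.ideal g).subset hx)]

theorem act_mem_mul {g h : G} (hgh : 𝔾.d g = 𝔾.r h) {y : R} (hy : y ∈ α.D (𝔾.inv g))
    (hy' : y ∈ α.D h) : α.act g y ∈ α.D (𝔾.mul g h) := by
  obtain ⟨x, hx, rfl⟩ := (α.bijOn h).surjOn hy'
  rw [α.comp_cond g h hgh x hx hy]
  exact (α.bijOn _).mapsTo (α.dom_cond g h hgh x hx hy)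

/-- The map `x ↦ α_g(x 1_{g⁻¹})`, as a ring endomorphism of `R` that need not preserve `1`. -/
noncomputable def hom (H : HasCentralUnits α one) (g : G) : R →ₙ+* R where
  toFun x := α.act g (x * one (𝔾.inv g))
  map_zero' := by
    have h0 := (α.ideal (𝔾.inv g)).zero_mem
    have h := α.map_add g 0 h0 0 h0
    rw [add_zero] at h
    rw [zero_mul]
    exact left_eq_add.mp h
  map_add' x y := by
    rw [add_mul]
    exact α.map_add g _ (H.mul_one_mem _ x) _ (H.mul_one_mem _ y)
  map_mul' x y := by
    rw [← α.map_mul g _ (H.mul_one_mem _ x) _ (H.mul_one_mem _ y), mul_assoc x (one _),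
      ← mul_assoc (one _) y, H.central, mul_assoc y, H.mul_one_of_mem (H.one_mem _), mul_assoc]

theorem hom_apply (H : HasCentralUnits α one)
    (g : G) (x : R) : H.hom g x = α.act g (x * one (𝔾.inv g)) := rfl

theorem hom_of_mem (H : HasCentralUnits α one)
    {g : G} {x : R} (hx : x ∈ α.D (𝔾.inv g)) : H.hom g x = α.act g x := by
  rw [hom_apply, H.mul_one_of_mem hx]

theorem hom_mem (H : HasCentralUnits α one) (g : G) (x : R) : H.hom g x ∈ α.D g :=
  (α.bijOn g).mapsTo (H.mul_one_mem _ x)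

theorem hom_mul_one (H : HasCentralUnits α one) (g : G) (x : R) : H.hom g x * one g = H.hom g x :=
  H.mul_one_of_mem (H.hom_mem g x)

theorem mul_one_r_of_mem (H : HasCentralUnits α one)
    {g : G} {x : R} (hx : x ∈ α.D g) : x * one (𝔾.r g) = x :=
  H.mul_one_of_mem ((α.ideal g).subset hx)

theorem hom_one_eq (H : HasCentralUnits α one) (g : G) : H.hom g 1 = one g := by
  obtain ⟨x, hx, hxg⟩ := (α.bijOn g).surjOn (H.one_mem g)
  rw [← H.hom_of_mem hx] at hxg
  calc H.hom g 1 = H.hom g 1 * one g := (H.hom_mul_one _ _).symm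
    _ = one g := by rw [← hxg, ← map_mul, one_mul]

theorem hom_isId (H : HasCentralUnits α one)
    {e : G} (he : 𝔾.isId e) (x : R) : H.hom e x = x * one e := by
  rw [hom_apply, he.inv_eq]
  exact α.act_id e he _ (H.mul_one_mem e x)

theorem hom_one_mul_one (H : HasCentralUnits α one) {g h : G} (hgh : 𝔾.d g = 𝔾.r h) :
    H.hom g (one h) = one g * one (𝔾.mul g h) := by
  have hd : 𝔾.d (𝔾.inv g) = 𝔾.r (𝔾.mul g h) := by rw [𝔾.d_inv, 𝔾.r_mul' _ _ hgh]
  have hu : H.hom g (one h) ∈ α.D (𝔾.mul g h) :=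
    act_mem_mul hgh (H.mul_one_mem _ _) (H.mul_mem_right (H.one_mem h) _)
  have hwg : one g * one (𝔾.mul g h) ∈ α.D g := H.mul_mem_right (H.one_mem g) _
  have hwi : one g * one (𝔾.mul g h) ∈ α.D (𝔾.inv (𝔾.inv g)) := by rwa [𝔾.inv_inv]
  have hz := act_mem_mul hd hwi (H.mul_one_mem _ _)
  rw [𝔾.mul_inv_cancel_left hgh] at hz
  have hzw : H.hom g (α.act (𝔾.inv g) (one g * one (𝔾.mul g h))) = one g * one (𝔾.mul g h) := by
    rw [H.hom_of_mem ((α.bijOn _).mapsTo hwi), act_act_inv hwg]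
  calc H.hom g (one h) = one g * one (𝔾.mul g h) * H.hom g (one h) := by
        rw [mul_assoc, H.central (𝔾.mul g h), H.mul_one_of_mem hu, H.central, H.hom_mul_one]
    _ = one g * one (𝔾.mul g h) := by
        rw [← hzw, ← map_mul, H.mul_one_of_mem hz]

theorem hom_hom (H : HasCentralUnits α one) {h g : G} (hhg : 𝔾.d h = 𝔾.r g) (x : R) :
    H.hom h (H.hom g x) = H.hom (𝔾.mul h g) x * one h := by
  have hd : 𝔾.d g = 𝔾.r (𝔾.inv (𝔾.mul h g)) := by rw [𝔾.r_inv, 𝔾.d_mul _ _ hhg]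
  have hd' : 𝔾.d (𝔾.mul h g) = 𝔾.r (𝔾.inv g) := by rw [𝔾.r_inv, 𝔾.d_mul _ _ hhg]
  have hk : H.hom g x * one (𝔾.inv h) = H.hom g (x * one (𝔾.inv (𝔾.mul h g))) := by
    rw [map_mul, H.hom_one_mul_one hd, 𝔾.mul_inv_mul_self hhg, ← mul_assoc, H.hom_mul_one]
  have hm : H.hom g (x * one (𝔾.inv (𝔾.mul h g))) ∈ α.D (𝔾.inv h) := by
    rw [← hk]; exact H.mul_one_mem _ _
  rw [H.hom_apply h, hk, H.hom_apply g,
    α.comp_cond h g hhg _ (H.mul_one_mem _ _) hm, mul_assoc, ← H.central (𝔾.inv g), ← mul_assoc,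
    ← H.hom_apply, map_mul, H.hom_one_mul_one hd', 𝔾.mul_inv_cancel_right hhg, ← mul_assoc,
    H.hom_mul_one]

theorem mul_eq_zero_of_r_ne (H : HasCentralUnits α one)
    {g h : G} (hgh : 𝔾.r g ≠ 𝔾.r h) {x y : R} (hx : x ∈ α.D g)
    (hy : y ∈ α.D h) : x * y = 0 :=
  H.orth _ _ (𝔾.isId_r_s19 g) (𝔾.isId_r_s19 h) hgh _ ((α.ideal g).subset hx) _ ((α.ideal h).subset hy)

theorem hom_hom_of_ne (H : HasCentralUnits α one)
    {h g : G} (hhg : 𝔾.d h ≠ 𝔾.r g) (x : R) : H.hom h (H.hom g x) = 0 := by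
  have h0 : H.hom g x * one (𝔾.inv h) = 0 * one (𝔾.inv h) := by
    rw [zero_mul]
    exact H.mul_eq_zero_of_r_ne (by rw [𝔾.r_inv]; exact hhg.symm) (H.hom_mem g x) (H.one_mem _)
  rw [H.hom_apply h, h0, ← H.hom_apply, map_zero]

theorem mem_invariants (H : HasCentralUnits α one)
    {x : R} : x ∈ invariants 𝔾 α one ↔ ∀ g, H.hom g x = x * one g := Iff.rfl

theorem mul_mem_invariants (H : HasCentralUnits α one) {x y : R} (hx : x ∈ invariants 𝔾 α one)
    (hy : y ∈ invariants 𝔾 α one) : x * y ∈ invariants 𝔾 α one := by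
  rw [H.mem_invariants] at *
  intro g
  rw [map_mul, hx, hy, mul_assoc, ← mul_assoc (one g), H.central, mul_assoc y,
    H.mul_one_of_mem (H.one_mem g), mul_assoc]

theorem one_mul_list_prod_eq_zero (H : HasCentralUnits α one) {e k b : G} (l : List G) (hb : b ∈ l)
    (hkb : 𝔾.mul k b = e) : one e * (l.map fun b => 1 - one (𝔾.mul k b)).prod = 0 := by
  induction l with
  | nil => simp at hb
  | cons a l ih =>
    rw [List.map_cons, List.prod_cons]
    rcases List.mem_cons.mp hb with rfl | hb
    · rw [hkb, ← mul_assoc, mul_one_sub, H.mul_one_of_mem (H.one_mem e), sub_self, zero_mul]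
    · rw [← mul_assoc, H.central, mul_assoc, ih hb, mul_zero]

theorem sum_hom_mul_hom (H : HasCentralUnits α one) [DecidableEq G] {n : ℕ} {xs ys : Fin n → R}
    (hxy : ∀ g, ∑ i, xs i * H.hom g (ys i) = if 𝔾.isId g then one g else 0) (h g : G) :
    ∑ i, H.hom h (xs i) * H.hom g (ys i) = if g = h then one h else 0 := by
  by_cases hr : 𝔾.r h = 𝔾.r g
  · have hd : 𝔾.d (𝔾.inv h) = 𝔾.r g := (𝔾.d_inv h).trans hr
    have hd' : 𝔾.d h = 𝔾.r (𝔾.mul (𝔾.inv h) g) := by rw [𝔾.r_mul' _ _ hd, 𝔾.r_inv]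
    have hs : ∑ i, H.hom h (xs i) * H.hom g (ys i) =
        H.hom h (∑ i, xs i * H.hom (𝔾.mul (𝔾.inv h) g) (ys i)) := by
      rw [map_sum]
      refine Finset.sum_congr rfl fun i _ => ?_
      rw [map_mul, H.hom_hom hd', 𝔾.inv_mul_cancel_left hr, ← H.central, ← mul_assoc,
        H.hom_mul_one]
    rw [hs, hxy]
    by_cases hgh : g = h
    · subst hgh
      rw [𝔾.inv_mul, if_pos (𝔾.isId_d_s19 g), if_pos rfl, H.hom_one_mul_one (𝔾.r_d g).symm,
        𝔾.mul_d, H.mul_one_of_mem (H.one_mem g)]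
    · rw [if_neg fun hid => hgh (𝔾.eq_of_isId_inv_mul hr hid), if_neg hgh, map_zero]
  · rw [if_neg fun hgh => hr (by rw [hgh])]
    exact Finset.sum_eq_zero fun i _ =>
      H.mul_eq_zero_of_r_ne hr (H.hom_mem h _) (H.hom_mem g _)

section Finite

variable [Fintype G]

theorem traceMap_eq (H : HasCentralUnits α one) (x : R) : traceMap 𝔾 α one x = ∑ g, H.hom g x := rfl

theorem traceMap_mem_invariants (H : HasCentralUnits α one)
    (x : R) : traceMap 𝔾 α one x ∈ invariants 𝔾 α one := by
  classical
  rw [H.mem_invariants]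
  intro h
  rw [H.traceMap_eq, map_sum, Finset.sum_mul,
    ← Finset.sum_filter_of_ne (p := fun g => 𝔾.d h = 𝔾.r g)
      fun g _ hg => by_contra fun hne => hg (H.hom_hom_of_ne hne x),
    ← Finset.sum_filter_of_ne (p := fun g => 𝔾.r g = 𝔾.r h)
      fun g _ hg => by_contra fun hne =>
        hg (H.mul_eq_zero_of_r_ne hne (H.hom_mem g x) (H.one_mem h))]
  refine Finset.sum_bij' (fun g _ => 𝔾.mul h g) (fun k _ => 𝔾.mul (𝔾.inv h) k) ?_ ?_ ?_ ?_ ?_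
  · intro g hg
    simp only [Finset.mem_filter, Finset.mem_univ, true_and] at hg ⊢
    exact 𝔾.r_mul' _ _ hg
  · intro k hk
    simp only [Finset.mem_filter, Finset.mem_univ, true_and] at hk ⊢
    rw [𝔾.r_mul' _ _ ((𝔾.d_inv h).trans hk.symm), 𝔾.r_inv]
  · intro g hg
    exact 𝔾.mul_inv_cancel_left (Finset.mem_filter.mp hg).2
  · intro k hk
    exact 𝔾.inv_mul_cancel_left (Finset.mem_filter.mp hk).2.symm
  · intro g hg
    exact H.hom_hom (Finset.mem_filter.mp hg).2 x

theorem traceMap_mul (H : HasCentralUnits α one) {r : R} (hr : r ∈ invariants 𝔾 α one) (x : R) :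
    traceMap 𝔾 α one (r * x) = r * traceMap 𝔾 α one x := by
  rw [H.mem_invariants] at hr
  simp only [H.traceMap_eq, Finset.mul_sum, map_mul, hr]
  refine Finset.sum_congr rfl fun g _ => ?_
  rw [mul_assoc, H.central, H.hom_mul_one]

theorem exists_traceMap_eq_of_one (H : HasCentralUnits α one)
    {x : R} (hx : traceMap 𝔾 α one x = 1) {r : R}
    (hr : r ∈ invariants 𝔾 α one) : ∃ y, traceMap 𝔾 α one y = r :=
  ⟨r * x, by rw [H.traceMap_mul hr, hx, mul_one]⟩

theorem exists_traceMap_eq_one_of_isUnit (H : HasCentralUnits α one)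
    (hu : IsUnit (traceMap 𝔾 α one 1)) :
    ∃ x, traceMap 𝔾 α one x = 1 := by
  have hinv := H.traceMap_mem_invariants 1
  obtain ⟨c, hc⟩ := hu
  rw [← hc, H.mem_invariants] at hinv
  have hr : (↑c⁻¹ : R) ∈ invariants 𝔾 α one := by
    rw [H.mem_invariants]
    intro g
    have h1 : (c : R) * H.hom g ↑c⁻¹ = one g := by
      have h2 : H.hom g (c * ↑c⁻¹) = one g := by rw [Units.mul_inv, H.hom_one_eq]
      rwa [map_mul, hinv, mul_assoc, H.central, H.hom_mul_one] at h2
    rw [← h1, Units.inv_mul_cancel_left]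
  exact ⟨(↑c⁻¹ : R), by rw [← mul_one (↑c⁻¹ : R), H.traceMap_mul hr, ← hc, Units.inv_mul]⟩

variable [DecidableEq G]

theorem sum_hom_list_prod (H : HasCentralUnits α one) {e : G} (l : List G)
    (hl : ∀ b ∈ l, 𝔾.d b = e ∧ 𝔾.r b = e) :
    ∃ y : R, ∑ g ∈ Finset.univ.filter (fun g => 𝔾.d g = e ∧ 𝔾.r g = e), H.hom g y =
      ∑ k ∈ Finset.univ.filter (fun g => 𝔾.d g = e ∧ 𝔾.r g = e),
        (1 - (l.map fun b => 1 - one (𝔾.mul k b)).prod) := by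
  have key : ∀ (g k : G) (m : List G), 𝔾.d g = 𝔾.r k → (∀ b ∈ m, 𝔾.d k = 𝔾.r b) →
      H.hom g (m.map fun b => 1 - one (𝔾.mul k b)).prod =
        one g * (m.map fun b => 1 - one (𝔾.mul (𝔾.mul g k) b)).prod := by
    intro g k m hgk
    induction m with
    | nil => intro _; simp [H.hom_one_eq]
    | cons b m ih =>
      intro hm
      have hkb := hm b (by simp)
      rw [List.map_cons, List.prod_cons, map_mul, ih fun b hb => hm b (by simp [hb]), map_sub,
        H.hom_one_eq, H.hom_one_mul_one (hgk.trans (𝔾.r_mul' _ _ hkb).symm),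
        ← 𝔾.mul_assoc' _ _ _ hgk hkb, List.map_cons, List.prod_cons, ← mul_one_sub,
        mul_assoc, ← mul_assoc _ (one g), ← H.central, ← mul_assoc, ← mul_assoc,
        H.mul_one_of_mem (H.one_mem g), mul_assoc]
  induction l with
  | nil => exact ⟨0, by simp⟩
  | cons a l ih =>
    obtain ⟨y, hy⟩ := ih fun b hb => hl b (by simp [hb])
    obtain ⟨had, har⟩ := hl a (by simp)
    refine ⟨y + (l.map fun b => 1 - one (𝔾.mul (𝔾.inv a) b)).prod, ?_⟩
    simp only [map_add, Finset.sum_add_distrib, hy]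
    have hs : ∑ g ∈ Finset.univ.filter (fun g => 𝔾.d g = e ∧ 𝔾.r g = e),
          H.hom g (l.map fun b => 1 - one (𝔾.mul (𝔾.inv a) b)).prod =
        ∑ k ∈ Finset.univ.filter (fun g => 𝔾.d g = e ∧ 𝔾.r g = e),
          one (𝔾.mul k a) * (l.map fun b => 1 - one (𝔾.mul k b)).prod := by
      refine Finset.sum_bij' (fun g _ => 𝔾.mul g (𝔾.inv a)) (fun k _ => 𝔾.mul k a)
        ?_ ?_ ?_ ?_ ?_
      all_goals
        intro g hg
        simp only [Finset.mem_filter, Finset.mem_univ, true_and] at hg ⊢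
        have h1 : 𝔾.d g = 𝔾.r (𝔾.inv a) := by rw [𝔾.r_inv, hg.1, had]
        have h2 : 𝔾.d g = 𝔾.r a := by rw [hg.1, har]
      · rw [𝔾.d_mul _ _ h1, 𝔾.r_mul' _ _ h1, 𝔾.d_inv]
        exact ⟨har, hg.2⟩
      · rw [𝔾.d_mul _ _ h2, 𝔾.r_mul' _ _ h2]
        exact ⟨had, hg.2⟩
      · exact 𝔾.inv_mul_cancel_right (by rw [hg.1, had])
      · exact 𝔾.mul_inv_cancel_right h2
      · rw [key g _ l h1 fun b hb => by rw [𝔾.d_inv, har, (hl b (by simp [hb])).2],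
          𝔾.inv_mul_cancel_right (by rw [hg.1, had])]
    rw [hs, ← Finset.sum_add_distrib]
    refine Finset.sum_congr rfl fun k _ => ?_
    rw [List.map_cons, List.prod_cons]
    noncomm_ring

theorem exists_isotropy_trace_eq (H : HasCentralUnits α one) (e : G) :
    ∃ y : R, ∑ g ∈ Finset.univ.filter (fun g => 𝔾.d g = e ∧ 𝔾.r g = e), H.hom g y =
      (Fintype.card {g : G // 𝔾.d g = e ∧ 𝔾.r g = e}) • one e := by
  obtain ⟨y, hy⟩ := H.sum_hom_list_prod (e := e)
    (Finset.univ.filter (fun g => 𝔾.d g = e ∧ 𝔾.r g = e)).toList (by simp)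
  refine ⟨y, ?_⟩
  have h1 : ∑ g ∈ Finset.univ.filter (fun g => 𝔾.d g = e ∧ 𝔾.r g = e), H.hom g y =
      one e * ∑ g ∈ Finset.univ.filter (fun g => 𝔾.d g = e ∧ 𝔾.r g = e), H.hom g y := by
    rw [Finset.mul_sum]
    refine Finset.sum_congr rfl fun g hg => ?_
    have hr := H.mul_one_r_of_mem (H.hom_mem g y)
    rw [(Finset.mem_filter.mp hg).2.2] at hr
    rw [H.central, hr]
  rw [h1, hy, Finset.mul_sum, Finset.sum_congr rfl (g := fun _ => one e), Finset.sum_const,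
    Fintype.card_subtype]
  intro k hk
  obtain ⟨hd, hr⟩ := (Finset.mem_filter.mp hk).2
  rw [mul_one_sub, H.one_mul_list_prod_eq_zero _ (b := 𝔾.inv k) _ ((𝔾.mul_inv k).trans hr),
    sub_zero]
  simp [𝔾.d_inv, 𝔾.r_inv, hd, hr]

theorem exists_traceMap_eq_one_isId (H : HasCentralUnits α one) {e : G} (he : 𝔾.isId e)
    (hv : ∃ v ∈ α.D e,
      ((Fintype.card {g : G // 𝔾.d g = e ∧ 𝔾.r g = e}) • one e) * v = one e)
    (ht : ∀ x ∈ α.D e, traceMap 𝔾 α one x =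
      ∑ g ∈ Finset.univ.filter (fun g => 𝔾.d g = e ∧ 𝔾.r g = e), H.hom g x) :
    ∃ x, traceMap 𝔾 α one x = one e := by
  obtain ⟨v, hvD, hv⟩ := hv
  obtain ⟨y, hy⟩ := H.exists_isotropy_trace_eq e
  have hev : one e * v = v := (H.central e v).trans (H.mul_one_of_mem hvD)
  rw [smul_mul_assoc, hev] at hv
  refine ⟨v * y, ?_⟩
  rw [ht _ (H.mul_mem_right hvD y)]
  have hvg : ∀ g, 𝔾.d g = e ∧ 𝔾.r g = e → H.hom g v = v * one g := by
    rintro g ⟨hd, hr⟩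
    have h1 : (Fintype.card {g : G // 𝔾.d g = e ∧ 𝔾.r g = e}) • H.hom g v = one g := by
      rw [← map_nsmul, hv, H.hom_one_mul_one (by rw [hd, he.r_eq]), ← hd, 𝔾.mul_d,
        H.mul_one_of_mem (H.one_mem g)]
    have hre := H.mul_one_r_of_mem (H.hom_mem g v)
    rw [hr] at hre
    rw [← h1, mul_smul_comm, ← smul_mul_assoc, hv, H.central, hre]
  calc ∑ g ∈ Finset.univ.filter (fun g => 𝔾.d g = e ∧ 𝔾.r g = e), H.hom g (v * y)
      = ∑ g ∈ Finset.univ.filter (fun g => 𝔾.d g = e ∧ 𝔾.r g = e), v * H.hom g y := by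
        refine Finset.sum_congr rfl fun g hg => ?_
        rw [map_mul, hvg g (Finset.mem_filter.mp hg).2, mul_assoc, H.central, H.hom_mul_one]
    _ = one e := by
        rw [← Finset.mul_sum, hy, mul_smul_comm, H.mul_one_of_mem hvD, hv]

theorem sum_mul_traceMap (H : HasCentralUnits α one)
    (hunit : (1 : R) = ∑ e ∈ Finset.univ.filter (fun e => 𝔾.isId e), one e) {n : ℕ}
    {xs ys : Fin n → R}
    (hxy : ∀ g, ∑ i, xs i * H.hom g (ys i) = if 𝔾.isId g then one g else 0) (x : R) :
    ∑ i, xs i * traceMap 𝔾 α one (ys i * x) = x := by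
  simp only [H.traceMap_eq, Finset.mul_sum, map_mul]
  rw [Finset.sum_comm]
  simp only [← mul_assoc, ← Finset.sum_mul, hxy, ite_mul, zero_mul]
  rw [← Finset.sum_filter]
  calc _ = ∑ e ∈ Finset.univ.filter (fun e => 𝔾.isId e), one e * x := by
        refine Finset.sum_congr rfl fun e he => ?_
        rw [H.central, H.hom_mul_one, H.hom_isId (Finset.mem_filter.mp he).2, H.central]
    _ = x := by rw [← Finset.sum_mul, ← hunit, one_mul]

end Finite

end HasCentralUnits

/-- For commutative `R`, the invariants form a subring of `R`. -/
def HasCentralUnits.invariantSubring {G : Type u} {𝔾 : AlgGroupoid G} {R : Type u}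
    [CommRing R] {α : PartialGroupoidAction 𝔾 R (Set.univ : Set R)} {one : G → R}
    (H : HasCentralUnits α one) : Subring R where
  carrier := invariants 𝔾 α one
  mul_mem' := H.mul_mem_invariants
  one_mem' := (H.mem_invariants).mpr fun g => by rw [H.hom_one_eq, one_mul]
  add_mem' {x y} hx hy := (H.mem_invariants).mpr fun g => by
    rw [map_add, H.mem_invariants.mp hx, H.mem_invariants.mp hy, add_mul]
  zero_mem' := (H.mem_invariants).mpr fun g => by rw [map_zero, zero_mul]
  neg_mem' {x} hx := (H.mem_invariants).mpr fun g => by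
    rw [map_neg, H.mem_invariants.mp hx, neg_mul]

theorem HasCentralUnits.exists_traceMap_eq_one_of_comm {G : Type u} [Fintype G]
    [DecidableEq G] {𝔾 : AlgGroupoid G} {R : Type u} [CommRing R]
    {α : PartialGroupoidAction 𝔾 R (Set.univ : Set R)} {one : G → R} (H : HasCentralUnits α one)
    (hunit : (1 : R) = ∑ e ∈ Finset.univ.filter (fun e => 𝔾.isId e), one e)
    (hgal : IsPartialGalois 𝔾 α one) : ∃ x, traceMap 𝔾 α one x = 1 := by
  classical
  obtain ⟨n, xs, ys, hxy⟩ := hgal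
  let S := H.invariantSubring
  let I : Ideal S :=
    { carrier := {s | ∃ x, traceMap 𝔾 α one x = s}
      zero_mem' := ⟨0, by simp [H.traceMap_eq]⟩
      add_mem' := by
        rintro _ _ ⟨x, hx⟩ ⟨y, hy⟩
        refine ⟨x + y, ?_⟩
        rw [Subring.coe_add, ← hx, ← hy]
        simp [H.traceMap_eq, Finset.sum_add_distrib]
      smul_mem' := by
        rintro c s ⟨x, hx⟩
        exact ⟨c * x, by rw [H.traceMap_mul c.2, hx]; rfl⟩ }
  have hspan : ∀ x : R, x = ∑ i,
      (⟨traceMap 𝔾 α one (ys i * x), H.traceMap_mem_invariants _⟩ : S) • xs i := by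
    intro x
    conv_lhs => rw [← H.sum_mul_traceMap hunit hxy x]
    exact Finset.sum_congr rfl fun i _ => mul_comm _ _
  have hfg : (⊤ : Submodule S R).FG := by
    refine ⟨Finset.univ.image xs, ?_⟩
    rw [eq_top_iff]
    intro x _
    rw [hspan x]
    exact Submodule.sum_mem _ fun i _ => Submodule.smul_mem _ _
      (Submodule.subset_span (by simp))
  have hle : (⊤ : Submodule S R) ≤ I • ⊤ := by
    intro x _
    rw [hspan x]
    exact Submodule.sum_mem _ fun i _ => Submodule.smul_mem_smul ⟨_, rfl⟩ trivial
  obtain ⟨s, hs, hs0⟩ := Submodule.exists_sub_one_mem_and_smul_eq_zero_of_fg_of_le_smul I ⊤ hfg hle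
  have hs0' : s = 0 := Subtype.ext (by simpa [Subring.smul_def] using hs0 1 trivial)
  obtain ⟨x, hx⟩ := hs
  rw [hs0'] at hx
  refine ⟨-x, ?_⟩
  rw [H.traceMap_eq] at hx ⊢
  simp [hx]

theorem SkewRingRep.map_sum {G : Type u} {𝔾 : AlgGroupoid G}
    {R : Type u} [Ring R] {α : PartialGroupoidAction 𝔾 R (Set.univ : Set R)} {A : Type u}
    [Ring A] (σ : SkewRingRep 𝔾 α A) (g : G) {ι : Type*} (s : Finset ι) (f : ι → R)
    (hf : ∀ i, f i ∈ α.D g) : σ.δ g (∑ i ∈ s, f i) = ∑ i ∈ s, σ.δ g (f i) ∧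
      ∑ i ∈ s, f i ∈ α.D g := by
  classical
  have h0 := (α.ideal g).zero_mem
  induction s using Finset.induction_on with
  | empty =>
    have h := σ.map_add g 0 h0 0 h0
    rw [add_zero] at h
    exact ⟨by simpa using h, by simpa using h0⟩
  | insert a s ha ih =>
    rw [Finset.sum_insert ha, Finset.sum_insert ha, σ.map_add g _ (hf a) _ ih.2, ih.1]
    exact ⟨rfl, (α.ideal g).add_mem (hf a) ih.2⟩

/-- **Corollary 5.4**: under the standing hypotheses, suppose at least one of
the following holds: (a) `R` is commutative; (b) `t_α(1_R)` is invertible in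
`R`; (c) for every `e ∈ G₀`, `|G_e|·1_e` is invertible in `D_e` and the
restriction of `t_α` to `D_e` is the trace map of the partial action
`α_{(e)}` of the isotropy group `G_e` on `D_e`.  Then `R` is an `α`-partial
Galois extension of `R^α` if and only if the Morita context
`(R⋆_αG, R^α, R, R, τ, τ')` is strict (`τ` and `τ'` surjective). -/
theorem partial_galois_iff_strict_context {G : Type u} [Nonempty G] [Fintype G]
    [DecidableEq G] (𝔾 : AlgGroupoid G) {R : Type u} [Ring R]
    (α : PartialGroupoidAction 𝔾 R (Set.univ : Set R))
    (one : G → R) (hone : ∀ g, IsIdentityElem (one g) (α.D g))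
    (hcentral : ∀ g (x : R), one g * x = x * one g)
    (horth : ∀ e f, 𝔾.isId e → 𝔾.isId f → e ≠ f → ∀ x ∈ α.D e, ∀ y ∈ α.D f, x * y = 0)
    (hunit : (1 : R) = ∑ e ∈ Finset.univ.filter (fun e => 𝔾.isId e), one e)
    {A : Type u} [Ring A] (σ : SkewRingRep 𝔾 α A)
    (h1A : (1 : A) = ∑ e ∈ Finset.univ.filter (fun e => 𝔾.isId e), σ.δ e (one e))
    (hyp :
      (∀ x y : R, x * y = y * x) ∨
      IsUnit (traceMap 𝔾 α one 1) ∨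
      (∀ e, 𝔾.isId e →
        (∃ v ∈ α.D e,
          ((Fintype.card {g : G // 𝔾.d g = e ∧ 𝔾.r g = e}) • one e) * v = one e ∧
          v * ((Fintype.card {g : G // 𝔾.d g = e ∧ 𝔾.r g = e}) • one e) = one e) ∧
        (∀ x ∈ α.D e, traceMap 𝔾 α one x =
          ∑ g ∈ Finset.univ.filter (fun g => 𝔾.d g = e ∧ 𝔾.r g = e),
            α.act g (x * one (𝔾.inv g))))) :
    IsPartialGalois 𝔾 α one ↔
      ((∀ r ∈ invariants 𝔾 α one, ∃ x : R, traceMap 𝔾 α one x = r) ∧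
       (∀ a : A, ∃ (k : ℕ) (xs ys : Fin k → R),
          a = ∑ i, ∑ g : G, σ.δ g (xs i * α.act g (ys i * one (𝔾.inv g))))) := by
  classical
  have H : HasCentralUnits α one := ⟨hone, hcentral, horth⟩
  have hmem : ∀ g x y, x * α.act g (y * one (𝔾.inv g)) ∈ α.D g :=
    fun g x y => H.mul_mem (H.hom_mem g y) x
  constructor
  · intro hgal
    constructor
    · have h1 : ∃ x, traceMap 𝔾 α one x = 1 := by
        rcases hyp with hcomm | hu | hiso
        · let _ : CommRing R := { ‹Ring R› with mul_comm := hcomm }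
          exact H.exists_traceMap_eq_one_of_comm hunit hgal
        · exact H.exists_traceMap_eq_one_of_isUnit hu
        · have hx : ∀ e : G, ∃ x, 𝔾.isId e → traceMap 𝔾 α one x = one e := by
            intro e
            by_cases he : 𝔾.isId e
            · obtain ⟨⟨v, hv, hv', -⟩, ht⟩ := hiso e he
              obtain ⟨x, hx⟩ := H.exists_traceMap_eq_one_isId he ⟨v, hv, hv'⟩ ht
              exact ⟨x, fun _ => hx⟩
            · exact ⟨0, fun h => absurd h he⟩
          choose x hx using hx
          refine ⟨∑ e ∈ Finset.univ.filter (fun e => 𝔾.isId e), x e, ?_⟩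
          rw [H.traceMap_eq]
          simp only [map_sum]
          rw [Finset.sum_comm, hunit]
          exact Finset.sum_congr rfl fun e he => hx e (Finset.mem_filter.mp he).2
      obtain ⟨x, hx⟩ := h1
      exact fun r hr => H.exists_traceMap_eq_of_one hx hr
    · obtain ⟨n, xs, ys, hxy⟩ := hgal
      intro a
      obtain ⟨s, c, hc, rfl⟩ := σ.spans a
      let ε := Fintype.equivFin (s × Fin n)
      refine ⟨_, fun j => c (ε.symm j).1 * H.hom (ε.symm j).1 (xs (ε.symm j).2),
        fun j => ys (ε.symm j).2, ?_⟩
      rw [Equiv.sum_comp ε.symm (fun p : s × Fin n => ∑ g : G, σ.δ g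
        (c p.1 * H.hom p.1 (xs p.2) * α.act g (ys p.2 * one (𝔾.inv g)))),
        Fintype.sum_prod_type, ← Finset.sum_coe_sort s]
      refine Finset.sum_congr rfl fun h _ => ?_
      rw [Finset.sum_comm]
      have hg : ∀ g, ∑ i, σ.δ g (c h * H.hom h (xs i) * α.act g (ys i * one (𝔾.inv g))) =
          if g = h then σ.δ h (c h) else 0 := by
        intro g
        rw [← (σ.map_sum g Finset.univ _ fun i => hmem g _ _).1]
        have hsum := H.sum_hom_mul_hom hxy h g
        simp only [H.hom_apply g] at hsum
        simp only [mul_assoc, ← Finset.mul_sum, hsum]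
        split_ifs with hgh
        · rw [hgh, H.mul_one_of_mem (hc h)]
        · rw [mul_zero]
          simpa using (σ.map_sum g (∅ : Finset ℕ) (fun _ => 0) fun _ => (α.ideal g).zero_mem).1
      simp only [hg, Finset.sum_ite_eq', Finset.mem_univ, if_true]
  · rintro ⟨-, hsurj⟩
    obtain ⟨n, xs, ys, hxy⟩ := hsurj (∑ e ∈ Finset.univ.filter (fun e => 𝔾.isId e), σ.δ e (one e))
    refine ⟨n, xs, ys, fun g => ?_⟩
    have hS := fun g => σ.map_sum g Finset.univ
      (fun i => xs i * α.act g (ys i * one (𝔾.inv g))) fun i => hmem g _ _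
    have hid : ∀ g, (if 𝔾.isId g then one g else 0) ∈ α.D g := by
      intro g
      split_ifs
      exacts [H.one_mem g, (α.ideal g).zero_mem]
    have hneg : ∀ g, -(if 𝔾.isId g then one g else 0) ∈ α.D g := fun g =>
      (α.ideal g).neg_mem (hid g)
    have hδ0 : ∀ g, σ.δ g 0 = 0 := fun g => by
      simpa using (σ.map_sum g (∅ : Finset ℕ) (fun _ => 0) fun _ => (α.ideal g).zero_mem).1
    have hδneg : ∀ g, σ.δ g (-(if 𝔾.isId g then one g else 0)) =
        -(if 𝔾.isId g then σ.δ g (one g) else 0) := by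
      intro g
      have h := σ.map_add g _ (hid g) _ (hneg g)
      rw [add_neg_cancel, hδ0] at h
      rw [eq_neg_of_add_eq_zero_right h.symm]
      split_ifs
      exacts [rfl, by rw [hδ0]]
    have h0 : ∑ g : G, σ.δ g (∑ i, xs i * α.act g (ys i * one (𝔾.inv g)) +
        -(if 𝔾.isId g then one g else 0)) = 0 := by
      rw [Finset.sum_congr rfl fun g _ => σ.map_add g _ (hS g).2 _ (hneg g),
        Finset.sum_add_distrib, Finset.sum_congr rfl fun g _ => (hS g).1, Finset.sum_comm, ← hxy,
        Finset.sum_filter, Finset.sum_congr rfl fun g _ => hδneg g, Finset.sum_neg_distrib,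
        add_neg_cancel]
    have := σ.indep Finset.univ _ (fun g => (α.ideal g).add_mem (hS g).2 (hneg g)) h0 g
      (Finset.mem_univ g)
    rwa [← sub_eq_add_neg, sub_eq_zero] at this
end
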